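/- Under Assumptions (A), the function d : Ω × Ω → ℝ is a (finite) distance. Moreover, there exists a positive constant c₁ depending on Ω and the X_i and, for every subdomain Ω' compactly contained in Ω, a positive constant c₂ depending on Ω' and the X_i, such that c₁|x − y| ≤ d(x,y) ≤ c₂|x − y|^{1/r} for all x, y ∈ Ω'. In particular, d induces the Euclidean topology. -/

import Mathlib

open MeasureTheory Set Topology

noncomputable section

/-- Euclidean space `ℝ^p`. -/
abbrev E (p : ℕ) : Type := EuclideanSpace ℝ (Fin p)

instance (p : ℕ) : Nonempty (E p) := ⟨0⟩

section Core

variable {V : Type*} [NormedAddCommGroup V] [NormedSpace ℝ V]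

/-- Commutator of two vector fields: `[X,Y] = (DY)·X - (DX)·Y`. -/
def vComm (X Y : V → V) : V → V :=
  fun x => fderiv ℝ Y x (X x) - fderiv ℝ X x (Y x)

/-- Left-iterated commutator `[X_{f 0},[X_{f 1},…,[X_{f (k-1)}, X_{f k}]…]]`. -/
def iterComm {ι : Type*} (X : ι → V → V) : (k : ℕ) → (Fin (k + 1) → ι) → V → V
  | 0, f => X (f 0)
  | k + 1, f => vComm (X (f 0)) (iterComm X k (fun j => f j.succ))

/-- Multiindices of length between `1` and `r` with entries in `ι`. -/
def MIdx (ι : Type*) (r : ℕ) : Type _ := Σ k : Fin r, (Fin (k.1 + 1) → ι)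

instance (ι : Type*) [Fintype ι] (r : ℕ) : Fintype (MIdx ι r) := by
  unfold MIdx; infer_instance

/-- Weight `|I|` of a multiindex relative to a weight function `w`. -/
def wtOf {ι : Type*} (w : ι → ℕ) {r : ℕ} (I : MIdx ι r) : ℕ := ∑ j, w (I.2 j)

/-- The iterated commutator `X_{[I]}` of a multiindex `I`. -/
def commOf {ι : Type*} (X : ι → V → V) {r : ℕ} (I : MIdx ι r) : V → V :=
  iterComm X I.1.1 I.2

/-- Standard weights: `X_0` has weight `2`, all the other fields weight `1`. -/
def wgt {n : ℕ} : Fin (n + 1) → ℕ := fun i => if i = 0 then 2 else 1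

/-- Hörmander's condition of weighted step `r` on the set `S`: the commutators
`X_{[I]}` with `|I| ≤ r` span the whole space at every point of `S`. -/
def HormSpan {ι : Type*} (X : ι → V → V) (w : ι → ℕ) (r : ℕ) (S : Set V) : Prop :=
  ∀ x ∈ S, Submodule.span ℝ {v : V | ∃ I : MIdx ι r, wtOf w I ≤ r ∧ v = commOf X I x} = ⊤

end Core

section Dist

variable {V : Type*} [NormedAddCommGroup V] [NormedSpace ℝ V] [CompleteSpace V]

/-- `φ` is an admissible curve of class `C(δ)` (for the subelliptic distance `d`)
inside `S`, joining `x` to `y`: it is an (absolutely continuous) integral of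
`∑_{|I| ≤ r} a_I(t) (X_{[I]})_{φ(t)}` with `|a_I| ≤ δ^{|I|}`. -/
def IsAdmissible {ι : Type*} [Fintype ι] {r : ℕ} (X : ι → V → V) (w : ι → ℕ)
    (S : Set V) (δ : ℝ) (x y : V) (φ : ℝ → V) : Prop :=
  ∃ a : MIdx ι r → ℝ → ℝ,
    (∀ t ∈ Icc (0:ℝ) 1, φ t ∈ S) ∧ φ 0 = x ∧ φ 1 = y ∧
    (∀ I, Measurable (a I)) ∧
    (∀ I, ∀ t ∈ Icc (0:ℝ) 1, |a I t| ≤ δ ^ wtOf w I) ∧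
    (∀ I : MIdx ι r, r < wtOf w I → ∀ t, a I t = 0) ∧
    ∀ t ∈ Icc (0:ℝ) 1,
      φ t = x + ∫ s in (0:ℝ)..t, ∑ I : MIdx ι r, a I s • commOf X I (φ s)

/-- The subelliptic (Nagel–Stein–Wainger) distance `d` attached to the system `X`. -/
def dCC {ι : Type*} [Fintype ι] (X : ι → V → V) (w : ι → ℕ) (r : ℕ)
    (S : Set V) (x y : V) : ℝ :=
  sInf {δ : ℝ | 0 < δ ∧ ∃ φ : ℝ → V, IsAdmissible (r := r) X w S δ x y φ}

/-- Metric ball of the subelliptic distance `d`. -/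
def BCC {ι : Type*} [Fintype ι] (X : ι → V → V) (w : ι → ℕ) (r : ℕ)
    (S : Set V) (x : V) (ρ : ℝ) : Set V :=
  {y | dCC X w r S x y < ρ}

/-- `φ` is an admissible curve of class `C_1(δ)` (for the control distance `d_1`)
inside `S`, joining `x` to `y`: `φ' = ∑_i a_i(t) (X_i)_{φ(t)}` with `|a_i| ≤ δ^{p_i}`. -/
def IsCtrlAdmissible {ι : Type*} [Fintype ι] (X : ι → V → V) (w : ι → ℕ)
    (S : Set V) (δ : ℝ) (x y : V) (φ : ℝ → V) : Prop :=
  ∃ a : ι → ℝ → ℝ,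
    (∀ t ∈ Icc (0:ℝ) 1, φ t ∈ S) ∧ φ 0 = x ∧ φ 1 = y ∧
    (∀ i, Measurable (a i)) ∧
    (∀ i, ∀ t ∈ Icc (0:ℝ) 1, |a i t| ≤ δ ^ w i) ∧
    ∀ t ∈ Icc (0:ℝ) 1,
      φ t = x + ∫ s in (0:ℝ)..t, ∑ i, a i s • X i (φ s)

/-- The control distance `d_1` attached to the system `X`. -/
def dCtrl {ι : Type*} [Fintype ι] (X : ι → V → V) (w : ι → ℕ)
    (S : Set V) (x y : V) : ℝ :=
  sInf {δ : ℝ | 0 < δ ∧ ∃ φ : ℝ → V, IsCtrlAdmissible X w S δ x y φ}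

/-- Metric ball of the control distance `d_1`. -/
def BCtrl {ι : Type*} [Fintype ι] (X : ι → V → V) (w : ι → ℕ)
    (S : Set V) (x : V) (ρ : ℝ) : Set V :=
  {y | dCtrl X w S x y < ρ}

/-- `x` and `y` are joined, within `W`, by a curve composed of a finite number of
arcs of integral curves of the vector fields `X_i`. -/
def IsIntegralArcChain {ι : Type*} (X : ι → V → V) (W : Set V) (x y : V) : Prop :=
  ∃ N : ℕ, ∃ z : Fin (N + 1) → V, z 0 = x ∧ z (Fin.last N) = y ∧
    ∀ j : Fin N, ∃ (i : ι) (c : ℝ) (γ : ℝ → V),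
      γ 0 = z j.castSucc ∧ γ 1 = z j.succ ∧ (∀ t ∈ Icc (0:ℝ) 1, γ t ∈ W) ∧
      ∀ t ∈ Icc (0:ℝ) 1, HasDerivAt γ (c • X i (γ t)) t

end Dist

/-- The Taylor-polynomial vector field of degree `m` centered at `x₀` which
approximates `Xi` (derivatives taken within `S`). -/
def taylorVF {p : ℕ} (Xi : E p → E p) (S : Set (E p)) (m : ℕ) (x₀ : E p) : E p → E p :=
  fun x => ∑ k ∈ Finset.range (m + 1),
    (k.factorial : ℝ)⁻¹ • iteratedFDerivWithin ℝ k Xi S x₀ (fun _ => x - x₀)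

section Exp

variable {V : Type*} [NormedAddCommGroup V] [NormedSpace ℝ V] [CompleteSpace V]

open scoped Classical in
/-- `expVF X x = exp(X)(x)`: the time-one value of an integral curve of `X`
issued from `x` (chosen by choice; under Lipschitz assumptions this is the
unique flow). -/
def expVF (X : V → V) (x : V) : V :=
  if h : ∃ φ : ℝ → V, φ 0 = x ∧ ∀ t ∈ Icc (0:ℝ) 1, φ t = x + ∫ s in (0:ℝ)..t, X (φ s)
  then h.choose 1 else x

/-- The maps `𝒞_l(t_1,…,t_l)` built from exponentials of the fields
`X_{f 0},…,X_{f k}` with independent parameters `t_0,…,t_k`. -/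
def mqExp {ι : Type*} (X : ι → V → V) :
    (k : ℕ) → (Fin (k + 1) → ι) → (Fin (k + 1) → ℝ) → V → V
  | 0, f, t => expVF (fun y => t 0 • X (f 0) y)
  | k + 1, f, t => fun x =>
      haveI : Nonempty V := ⟨0⟩
      Function.invFun (mqExp X k (fun j => f j.succ) (fun j => t j.succ))
        (expVF (fun y => (-(t 0)) • X (f 0) y)
          (mqExp X k (fun j => f j.succ) (fun j => t j.succ)
            (expVF (fun y => t 0 • X (f 0) y) x)))

/-- The iterated mixed derivative `∂^l G/∂t_1⋯∂t_l` at the origin. -/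
def mixedDeriv : (l : ℕ) → ((Fin l → ℝ) → V → V) → V → V
  | 0, G => G (fun i => i.elim0)
  | l + 1, G => mixedDeriv l (fun t x => deriv (fun s : ℝ => G (Fin.cons s t) x) 0)

/-- The quasiexponential map `C_{ℓ(I)}(t, X_I)`. -/
def qExpOf {ι : Type*} (X : ι → V → V) (w : ι → ℕ) (t : ℝ) {r : ℕ} (I : MIdx ι r) : V → V :=
  mqExp X I.1.1 I.2 (fun j => t ^ w (I.2 j))

/-- The map `E_I(t)`. -/
def Emap {ι : Type*} (X : ι → V → V) (w : ι → ℕ) {r : ℕ} (I : MIdx ι r)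
    (t : ℝ) : V → V :=
  haveI : Nonempty V := ⟨0⟩
  if 0 ≤ t then qExpOf X w (Real.rpow t ((wtOf w I : ℝ))⁻¹) I
  else Function.invFun (qExpOf X w (Real.rpow |t| ((wtOf w I : ℝ))⁻¹) I)

end Exp

/-- The map `E_η^X(x,h) = E_{I_1}(h_1) E_{I_2}(h_2) ⋯ E_{I_p}(h_p)(x)`. -/
def EmapFam {p : ℕ} {ι : Type*} {r : ℕ} (X : ι → E p → E p) (w : ι → ℕ)
    (η : Fin p → MIdx ι r) (x : E p) (h : Fin p → ℝ) : E p :=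
  (List.ofFn fun j : Fin p => Emap X w (η j) (h j)).foldr (fun f y => f y) x

/-- `λ_η(x)`: the determinant of the `p × p` matrix whose rows are the
commutators `(X_{[I_j]})_x`, `I_j ∈ η`. -/
def lamDet {p : ℕ} {ι : Type*} {r : ℕ} (X : ι → E p → E p) (η : Fin p → MIdx ι r)
    (x : E p) : ℝ :=
  Matrix.det (Matrix.of fun j k => commOf X (η j) x k)

/-- The differential operator `X_i` acting on a scalar function. -/
def Xop {p : ℕ} (Xi : E p → E p) (f : E p → ℝ) (y : E p) : ℝ := fderiv ℝ f y (Xi y)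

/-- `|Xf(y)| = (∑_i |X_i f(y)|²)^{1/2}`. -/
def gradLen {p n : ℕ} (X : Fin n → E p → E p) (f : E p → ℝ) (y : E p) : ℝ :=
  Real.sqrt (∑ i, (Xop (X i) f y) ^ 2)

/-- The formal adjoint `X_i^*` acting on a scalar function:
`X_i^* f = -∑_j ∂_{y_j} (b_{ij} f)`. -/
def XstarOp {p : ℕ} (Xi : E p → E p) (f : E p → ℝ) (y : E p) : ℝ :=
  - ∑ j, fderiv ℝ (fun z => Xi z j * f z) y (EuclideanSpace.single j 1)

section Free

/-- Left-iterated bracket in the free Lie algebra on `n` generators. -/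
def freeBracket {n : ℕ} : (k : ℕ) → (Fin (k + 1) → Fin n) → FreeLieAlgebra ℝ (Fin n)
  | 0, f => FreeLieAlgebra.of ℝ (f 0)
  | k + 1, f => ⁅FreeLieAlgebra.of ℝ (f 0), freeBracket k (fun j => f j.succ)⁆

/-- The free bracket associated to a multiindex. -/
def freeBracketOf {n r : ℕ} (I : MIdx (Fin n) r) : FreeLieAlgebra ℝ (Fin n) :=
  freeBracket I.1.1 I.2

/-- Submodule of the free Lie algebra spanned by left-iterated brackets of
length `> r`. -/
def longBrackets (n r : ℕ) : Submodule ℝ (FreeLieAlgebra ℝ (Fin n)) :=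
  Submodule.span ℝ {z | ∃ k : ℕ, r ≤ k ∧ ∃ f : Fin (k + 1) → Fin n, z = freeBracket k f}

/-- The system `X` is free up to step `r` on `S`: every linear relation among
the iterated commutators of length `≤ r` at a point of `S` follows from
anticommutativity and the Jacobi identity (i.e. it already holds in the free
nilpotent Lie algebra of step `r`). -/
def FreeUpTo {V : Type*} [NormedAddCommGroup V] [NormedSpace ℝ V] {n : ℕ}
    (X : Fin n → V → V) (r : ℕ) (S : Set V) : Prop :=
  ∀ x ∈ S, ∀ c : MIdx (Fin n) r → ℝ,
    (∑ I, c I • commOf X I x) = 0 →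
    (∑ I, c I • freeBracketOf I) ∈ longBrackets n r

end Free

section Regularity

variable {V W : Type*} [NormedAddCommGroup V] [NormedSpace ℝ V]
  [NormedAddCommGroup W] [NormedSpace ℝ W]

/-- Near every point of `closure S`, the map `g` agrees on `S` with a map which is `C^m` up to
that point. -/
def SmoothUpTo (S : Set V) (m : ℕ) (g : V → W) : Prop :=
  ∀ x ∈ closure S, ∃ h : V → W, ContDiffWithinAt ℝ m h S x ∧ g =ᶠ[𝓝[S] x] h

theorem ContDiffOn.smoothUpTo {S : Set V} {m : ℕ} {g : V → W}
    (hg : ContDiffOn ℝ m g (closure S)) : SmoothUpTo S m g :=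
  fun x hx => ⟨g, (hg x hx).mono subset_closure, Filter.EventuallyEq.rfl⟩

namespace SmoothUpTo

theorem of_le {S : Set V} {m k : ℕ} {g : V → W} (hg : SmoothUpTo S m g) (h : k ≤ m) :
    SmoothUpTo S k g := by
  intro x hx
  obtain ⟨g', h1, h2⟩ := hg x hx
  exact ⟨g', h1.of_le (by exact_mod_cast h), h2⟩

theorem sub {S : Set V} {m : ℕ} {g₁ g₂ : V → W} (h₁ : SmoothUpTo S m g₁)
    (h₂ : SmoothUpTo S m g₂) : SmoothUpTo S m (fun x => g₁ x - g₂ x) := by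
  intro x hx
  obtain ⟨f₁, a₁, b₁⟩ := h₁ x hx
  obtain ⟨f₂, a₂, b₂⟩ := h₂ x hx
  exact ⟨fun x => f₁ x - f₂ x, a₁.sub a₂, b₁.sub b₂⟩

theorem clm_apply {S : Set V} {m : ℕ} {A : V → V →L[ℝ] W} {g : V → V} (hA : SmoothUpTo S m A)
    (hg : SmoothUpTo S m g) : SmoothUpTo S m (fun x => A x (g x)) := by
  intro x hx
  obtain ⟨f₁, a₁, b₁⟩ := hA x hx
  obtain ⟨f₂, a₂, b₂⟩ := hg x hx
  refine ⟨fun x => f₁ x (f₂ x), a₁.clm_apply a₂, ?_⟩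
  filter_upwards [b₁, b₂] with y h1 h2
  rw [h1, h2]

theorem fderiv {S : Set V} (hS : IsOpen S) {m : ℕ} {g : V → W} (hg : SmoothUpTo S (m + 1) g) :
    SmoothUpTo S m (fderiv ℝ g) := by
  intro x hx
  obtain ⟨f, a, b⟩ := hg x hx
  obtain ⟨u, hu, -, -, f', hf', hc⟩ :=
    (contDiffWithinAt_succ_iff_hasFDerivWithinAt' (n := (m : WithTop ℕ∞)) (by simp)).1
      (by exact_mod_cast a)
  refine ⟨f', hc, ?_⟩
  have hu' : u ∈ 𝓝[S] x := nhdsWithin_mono x (subset_insert x S) hu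
  filter_upwards [hu', self_mem_nhdsWithin, eventually_eventually_nhdsWithin.2 b] with y hy hyS hyb
  rw [hS.nhdsWithin_eq hyS] at hyb
  rw [Filter.EventuallyEq.fderiv_eq hyb]
  exact ((hf' y hy).hasFDerivAt (hS.mem_nhds hyS)).fderiv

theorem vComm {S : Set V} (hS : IsOpen S) {m k l : ℕ} {X Y : V → V} (hX : SmoothUpTo S k X)
    (hY : SmoothUpTo S l Y) (hk : m + 1 ≤ k) (hl : m + 1 ≤ l) : SmoothUpTo S m (vComm X Y) :=
  (((hY.of_le hl).fderiv hS).clm_apply (hX.of_le (by omega))).sub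
    (((hX.of_le hk).fderiv hS).clm_apply (hY.of_le (by omega)))

theorem continuousOn {S : Set V} {m : ℕ} {g : V → W} (hg : SmoothUpTo S m g) :
    ContinuousOn g S := by
  intro x hx
  obtain ⟨f, a, b⟩ := hg x (subset_closure hx)
  exact a.continuousWithinAt.congr_of_eventuallyEq b (b.self_of_nhdsWithin hx)

theorem exists_bound {S : Set V} (hS : IsCompact (closure S)) {m : ℕ} {g : V → W}
    (hg : SmoothUpTo S m g) : ∃ C : ℝ, ∀ x ∈ S, ‖g x‖ ≤ C := by
  have key : ∃ C : ℝ, ∀ x ∈ closure S, x ∈ S → ‖g x‖ ≤ C := by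
    refine hS.induction_on (p := fun T => ∃ C : ℝ, ∀ x ∈ T, x ∈ S → ‖g x‖ ≤ C)
      ⟨0, by simp⟩ ?_ ?_ ?_
    · rintro s t hst ⟨C, hC⟩
      exact ⟨C, fun x hx => hC x (hst hx)⟩
    · rintro s t ⟨C, hC⟩ ⟨D, hD⟩
      refine ⟨max C D, fun x hx hxS => ?_⟩
      rcases hx with hx | hx
      · exact (hC x hx hxS).trans (le_max_left _ _)
      · exact (hD x hx hxS).trans (le_max_right _ _)
    · intro x hx
      obtain ⟨f, a, b⟩ := hg x hx
      have h1 : ∀ᶠ y in 𝓝[S] x, ‖f y‖ < ‖f x‖ + 1 :=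
        a.continuousWithinAt.norm (Iio_mem_nhds (lt_add_one _))
      have h2 : ∀ᶠ y in 𝓝[S] x, ‖g y‖ ≤ ‖f x‖ + 1 := by
        filter_upwards [h1, b] with y hy1 hy2
        rw [hy2]; exact hy1.le
      exact ⟨{y | y ∈ S → ‖g y‖ ≤ ‖f x‖ + 1},
        mem_nhdsWithin_of_mem_nhds (eventually_nhdsWithin_iff.1 h2), ‖f x‖ + 1, fun y hy => hy⟩
  obtain ⟨C, hC⟩ := key
  exact ⟨C, fun x hx => hC x (subset_closure hx) hx⟩

theorem iterComm {ι : Type*} {S : Set V} (hS : IsOpen S) {r : ℕ} {X : ι → V → V} {w : ι → ℕ}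
    (hw : ∀ i, 1 ≤ w i) (hX : ∀ i, SmoothUpTo S (r - w i) (X i)) :
    ∀ (k : ℕ) (f : Fin (k + 1) → ι), ∑ j, w (f j) ≤ r →
      SmoothUpTo S (r - ∑ j, w (f j)) (iterComm X k f) := by
  intro k
  induction k with
  | zero => intro f _; simpa [_root_.iterComm] using hX (f 0)
  | succ k ih =>
    intro f hf
    rw [Fin.sum_univ_succ] at hf ⊢
    have h0 := hw (f 0)
    have h1 : 1 ≤ ∑ j : Fin (k + 1), w (f j.succ) :=
      (hw (f (Fin.succ 0))).trans
        (Finset.single_le_sum (f := fun j : Fin (k + 1) => w (f j.succ))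
          (fun _ _ => Nat.zero_le _) (Finset.mem_univ 0))
    exact (hX (f 0)).vComm hS (ih (fun j => f j.succ) (by omega)) (by omega) (by omega)

end SmoothUpTo

theorem one_le_wtOf {ι : Type*} {w : ι → ℕ} (hw : ∀ i, 1 ≤ w i) {r : ℕ} (I : MIdx ι r) :
    1 ≤ wtOf w I :=
  (hw (I.2 0)).trans (Finset.single_le_sum (f := fun j => w (I.2 j))
    (fun _ _ => Nat.zero_le _) (Finset.mem_univ 0))

end Regularity

section Curves

variable {V : Type*} [NormedAddCommGroup V] [NormedSpace ℝ V]

/-- A bounded velocity field along a curve which satisfies the integral equation is integrable: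
the equation itself forces the curve to be piecewise continuous. -/
theorem intervalIntegrable_velocity {J : Type*} [Fintype J] {Y : J → V → V} {S : Set V}
    {a : J → ℝ → ℝ} {φ : ℝ → V} {x : V} {C : ℝ}
    (hY : ∀ j, (∀ t, a j t = 0) ∨ ContinuousOn (Y j) S) (ha : ∀ j, Measurable (a j))
    (hφS : ∀ t ∈ Icc (0:ℝ) 1, φ t ∈ S)
    (hC : ∀ t ∈ Icc (0:ℝ) 1, ‖∑ j, a j t • Y j (φ t)‖ ≤ C)
    (hφ : ∀ t ∈ Icc (0:ℝ) 1, φ t = x + ∫ s in (0:ℝ)..t, ∑ j, a j s • Y j (φ s)) :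
    IntervalIntegrable (fun s => ∑ j, a j s • Y j (φ s)) volume 0 1 := by
  set F : ℝ → V := fun s => ∑ j, a j s • Y j (φ s) with hF
  set A : Set ℝ := {t | t ∈ Icc (0:ℝ) 1 ∧ IntervalIntegrable F volume 0 t} with hA
  have hAm : MeasurableSet A := by
    refine OrdConnected.measurableSet ⟨fun s hs t ht u hu => ⟨⟨hs.1.1.trans hu.1, hu.2.trans ht.1.2⟩,
      ht.2.mono_set ?_⟩⟩
    rw [uIcc_of_le (hs.1.1.trans hu.1), uIcc_of_le ht.1.1]
    exact Icc_subset_Icc_right hu.2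
  have hAc : ContinuousOn φ A := by
    have : LipschitzOnWith C.toNNReal φ A := by
      refine LipschitzOnWith.of_dist_le_mul fun s hs t ht => ?_
      rw [dist_eq_norm, hφ s hs.1, hφ t ht.1, add_sub_add_left_eq_sub,
        intervalIntegral.integral_interval_sub_left hs.2 ht.2, Real.dist_eq]
      refine intervalIntegral.norm_integral_le_of_norm_le_const fun u hu => ?_
      refine (hC u ?_).trans (Real.le_coe_toNNReal C)
      have := uIoc_subset_uIcc hu
      exact (uIcc_subset_Icc ht.1 hs.1) this
    exact this.continuousOn
  have hmA : AEStronglyMeasurable F (volume.restrict A) := by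
    refine Finset.aestronglyMeasurable_fun_sum _ fun j _ => ?_
    rcases hY j with h | h
    · simp only [h, zero_smul]; exact aestronglyMeasurable_const
    · exact (ha j).aestronglyMeasurable.smul
        ((h.comp hAc fun t ht => hφS t ht.1).aestronglyMeasurable hAm)
  have hmB : AEStronglyMeasurable F (volume.restrict (Icc 0 1 \ A)) := by
    have hconst : AEStronglyMeasurable (fun s => ∑ j, a j s • Y j x)
        (volume.restrict (Icc 0 1 \ A)) :=
      Finset.aestronglyMeasurable_fun_sum _ fun j _ =>
        (ha j).aestronglyMeasurable.smul aestronglyMeasurable_const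
    refine hconst.congr ?_
    filter_upwards [ae_restrict_mem (measurableSet_Icc.diff hAm)] with t ht
    have hx : φ t = x := by
      rw [hφ t ht.1, intervalIntegral.integral_undef (fun h => ht.2 ⟨ht.1, h⟩), add_zero]
    simp only [hF, hx]
  have hm : AEStronglyMeasurable F (volume.restrict (Icc 0 1)) := by
    have := (aestronglyMeasurable_union_iff (s := A) (t := Icc 0 1 \ A)).2 ⟨hmA, hmB⟩
    rwa [union_sdiff_cancel (fun t ht => ht.1)] at this
  rw [intervalIntegrable_iff_integrableOn_Icc_of_le zero_le_one]
  exact IntegrableOn.of_bound (by simp) hm C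
    ((ae_restrict_iff' measurableSet_Icc).2 (Filter.Eventually.of_forall hC))

theorem intervalIntegrable_comp_sub_div {F : ℝ → V} (hF : IntervalIntegrable F volume 0 1)
    (u c : ℝ) :
    IntervalIntegrable (fun s => c⁻¹ • F ((s - u) / c)) volume u (u + c) := by
  have h := ((hF.comp_mul_right (c := c⁻¹)).comp_sub_right u).smul (r := c⁻¹)
  have e1 : (0:ℝ) / c⁻¹ + u = u := by simp
  have e2 : (1:ℝ) / c⁻¹ + u = u + c := by simp [add_comm]
  rw [e1, e2] at h
  simpa only [div_eq_mul_inv, Pi.smul_def] using h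

theorem integral_comp_sub_div_scaled (F : ℝ → V) (u t : ℝ) {c : ℝ} (hc : 0 < c) :
    ∫ s in u..t, c⁻¹ • F ((s - u) / c) = ∫ s in (0:ℝ)..((t - u) / c), F s := by
  have h1 : ∀ s, (s - u) / c = s / c - u / c := fun s => by ring
  rw [intervalIntegral.integral_smul]
  simp only [h1]
  rw [intervalIntegral.integral_comp_div_sub (c := c) F hc.ne' (u / c), smul_smul,
    inv_mul_cancel₀ hc.ne', one_smul, sub_self]

theorem concat_integral_eq {φ₁ φ₂ F₁ F₂ : ℝ → V} {x y : V}
    (h₁ : IntervalIntegrable F₁ volume 0 1) (h₂ : IntervalIntegrable F₂ volume 0 1)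
    (e₁ : ∀ t ∈ Icc (0:ℝ) 1, φ₁ t = x + ∫ s in (0:ℝ)..t, F₁ s)
    (e₂ : ∀ t ∈ Icc (0:ℝ) 1, φ₂ t = y + ∫ s in (0:ℝ)..t, F₂ s)
    (hy : φ₁ 1 = y) {l : ℝ} (hl0 : 0 < l) (hl1 : l < 1) {t : ℝ} (ht : t ∈ Icc (0:ℝ) 1) :
    (if t ≤ l then φ₁ (t / l) else φ₂ ((t - l) / (1 - l))) =
      x + ∫ s in (0:ℝ)..t,
        if s ≤ l then l⁻¹ • F₁ (s / l) else (1 - l)⁻¹ • F₂ ((s - l) / (1 - l)) := by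
  have hl1' : 0 < 1 - l := sub_pos.2 hl1
  set G : ℝ → V := fun s => if s ≤ l then l⁻¹ • F₁ (s / l)
    else (1 - l)⁻¹ • F₂ ((s - l) / (1 - l)) with hG
  have left : ∀ t, 0 ≤ t → t ≤ l → ∫ s in (0:ℝ)..t, G s = ∫ s in (0:ℝ)..(t / l), F₁ s := by
    intro t ht0 htl
    have h := integral_comp_sub_div_scaled F₁ 0 t hl0
    rw [sub_zero] at h
    rw [← h]
    refine intervalIntegral.integral_congr fun s hs => ?_
    rw [uIcc_of_le ht0] at hs
    simp only [hG, sub_zero, if_pos (hs.2.trans htl)]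
  split_ifs with h
  · rw [left t ht.1 h, e₁ _ ⟨div_nonneg ht.1 hl0.le, (div_le_one hl0).2 h⟩]
  · have hlt : l < t := not_le.1 h
    have i₁ : IntervalIntegrable G volume 0 l := by
      have := intervalIntegrable_comp_sub_div h₁ 0 l
      rw [zero_add] at this
      refine this.congr fun s hs => ?_
      rw [uIoc_of_le hl0.le] at hs
      simp only [hG, sub_zero, if_pos hs.2]
    have eqG : ∀ s ∈ uIoc l t, (1 - l)⁻¹ • F₂ ((s - l) / (1 - l)) = G s := by
      intro s hs
      rw [uIoc_of_le hlt.le] at hs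
      simp only [hG, if_neg (not_le.2 hs.1)]
    have i₂ : IntervalIntegrable G volume l t := by
      have := intervalIntegrable_comp_sub_div h₂ l (1 - l)
      rw [add_sub_cancel] at this
      refine (this.mono_set ?_).congr eqG
      rw [uIcc_of_le hlt.le, uIcc_of_le hl1.le]
      exact Icc_subset_Icc_right ht.2
    have right : ∫ s in l..t, G s = ∫ s in (0:ℝ)..((t - l) / (1 - l)), F₂ s := by
      rw [← integral_comp_sub_div_scaled F₂ l t hl1']
      exact intervalIntegral.integral_congr_ae
        (Filter.Eventually.of_forall fun s hs => (eqG s hs).symm)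
    rw [← intervalIntegral.integral_add_adjacent_intervals i₁ i₂, right, left l hl0.le le_rfl,
      div_self hl0.ne', ← add_assoc, ← e₁ 1 (by simp), hy]
    exact e₂ _ ⟨div_nonneg (sub_nonneg.2 hlt.le) hl1'.le,
      (div_le_one hl1').2 (by linarith [ht.2])⟩

/-- The commutators of weight at most `r` are continuous and bounded on `S`, and the weights are
positive. -/
structure IsTame {ι : Type*} (X : ι → V → V) (w : ι → ℕ) (r : ℕ) (S : Set V) : Prop where
  one_le_weight : ∀ i, 1 ≤ w i
  continuousOn : ∀ I : MIdx ι r, wtOf w I ≤ r → ContinuousOn (commOf X I) S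
  bounded : ∃ M : ℝ, ∀ I : MIdx ι r, wtOf w I ≤ r → ∀ z ∈ S, ‖commOf X I z‖ ≤ M

theorem IsTame.exists_bound {ι : Type*} {X : ι → V → V} {w : ι → ℕ} {r : ℕ} {S : Set V}
    (hX : IsTame X w r S) :
    ∃ M : ℝ, 0 ≤ M ∧ ∀ I : MIdx ι r, wtOf w I ≤ r → ∀ z ∈ S, ‖commOf X I z‖ ≤ M := by
  obtain ⟨M, hM⟩ := hX.bounded
  exact ⟨max M 0, le_max_right _ _, fun I hI z hz => (hM I hI z hz).trans (le_max_left _ _)⟩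

/-- The points `x` and `y` are joined inside `S` by a curve of class `C(δ)`. -/
def IsJoined {ι : Type*} [Fintype ι] (X : ι → V → V) (w : ι → ℕ) (r : ℕ) (S : Set V) (δ : ℝ)
    (x y : V) : Prop :=
  0 < δ ∧ ∃ φ : ℝ → V, IsAdmissible (r := r) X w S δ x y φ

variable {ι : Type*} [Fintype ι] {X : ι → V → V} {w : ι → ℕ} {r : ℕ} {S : Set V}

theorem norm_velocity_le {M δ : ℝ} (hM0 : 0 ≤ M)
    (hM : ∀ I : MIdx ι r, wtOf w I ≤ r → ∀ z ∈ S, ‖commOf X I z‖ ≤ M) {a : MIdx ι r → ℝ}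
    (ha : ∀ I, |a I| ≤ δ ^ wtOf w I) (ha0 : ∀ I, r < wtOf w I → a I = 0) {z : V} (hz : z ∈ S) :
    ‖∑ I, a I • commOf X I z‖ ≤ ∑ I : MIdx ι r, δ ^ wtOf w I * M := by
  refine norm_sum_le_of_le _ fun I _ => ?_
  rw [norm_smul, Real.norm_eq_abs]
  have h0 : 0 ≤ δ ^ wtOf w I := (abs_nonneg _).trans (ha I)
  rcases le_or_gt (wtOf w I) r with h | h
  · exact mul_le_mul (ha I) (hM I h z hz) (norm_nonneg _) h0
  · rw [ha0 I h, abs_zero, zero_mul]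
    exact mul_nonneg h0 hM0

theorem IsTame.intervalIntegrable (hX : IsTame X w r S) {δ : ℝ} {x : V}
    {a : MIdx ι r → ℝ → ℝ} {φ : ℝ → V} (hφS : ∀ t ∈ Icc (0:ℝ) 1, φ t ∈ S)
    (ha : ∀ I, Measurable (a I)) (hab : ∀ I, ∀ t ∈ Icc (0:ℝ) 1, |a I t| ≤ δ ^ wtOf w I)
    (ha0 : ∀ I : MIdx ι r, r < wtOf w I → ∀ t, a I t = 0)
    (hφ : ∀ t ∈ Icc (0:ℝ) 1, φ t = x + ∫ s in (0:ℝ)..t, ∑ I : MIdx ι r, a I s • commOf X I (φ s)) :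
    IntervalIntegrable (fun s => ∑ I : MIdx ι r, a I s • commOf X I (φ s)) volume 0 1 := by
  obtain ⟨M, hM0, hM⟩ := hX.exists_bound
  refine intervalIntegrable_velocity (fun I => ?_) ha hφS
    (fun t ht => norm_velocity_le hM0 hM (fun I => hab I t ht) (fun I hI => ha0 I hI t) (hφS t ht)) hφ
  rcases le_or_gt (wtOf w I) r with h | h
  · exact Or.inr (hX.continuousOn I h)
  · exact Or.inl (ha0 I h)

theorem isJoined_refl {δ : ℝ} (hδ : 0 < δ) {x : V} (hx : x ∈ S) : IsJoined X w r S δ x x :=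
  ⟨hδ, fun _ => x, fun _ _ => 0, fun _ _ => hx, rfl, rfl, fun _ => measurable_const,
    fun _ _ _ => by simpa using pow_nonneg hδ.le _, fun _ _ _ => rfl, fun _ _ => by simp⟩

theorem IsJoined.symm (hX : IsTame X w r S) {δ : ℝ} {x y : V} (h : IsJoined X w r S δ x y) :
    IsJoined X w r S δ y x := by
  obtain ⟨hδ, φ, a, hφS, h0, h1, ha, hab, ha0, hφ⟩ := h
  have hint := hX.intervalIntegrable hφS ha hab ha0 hφ
  have hmem : ∀ t ∈ Icc (0:ℝ) 1, 1 - t ∈ Icc (0:ℝ) 1 := fun t ht =>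
    ⟨by linarith [ht.2], by linarith [ht.1]⟩
  refine ⟨hδ, fun t => φ (1 - t), fun I t => -a I (1 - t), fun t ht => hφS _ (hmem t ht),
    by simpa using h1, by simpa using h0,
    fun I => ((ha I).comp (measurable_const.sub measurable_id)).neg,
    fun I t ht => by rw [abs_neg]; exact hab I _ (hmem t ht),
    fun I hI t => by simp [ha0 I hI], fun t ht => ?_⟩
  simp only [neg_smul, Finset.sum_neg_distrib, intervalIntegral.integral_neg]
  rw [intervalIntegral.integral_comp_sub_left
    (fun s => ∑ I : MIdx ι r, a I s • commOf X I (φ s)) 1, sub_zero, ← h1, hφ 1 (by simp),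
    hφ _ (hmem t ht), ← sub_eq_add_neg, add_sub_assoc, add_right_inj, eq_sub_iff_add_eq]
  have hsub := hmem t ht
  refine intervalIntegral.integral_add_adjacent_intervals (hint.mono_set ?_) (hint.mono_set ?_)
  · rw [uIcc_of_le hsub.1, uIcc_of_le zero_le_one]
    exact Icc_subset_Icc_right hsub.2
  · rw [uIcc_of_le hsub.2, uIcc_of_le zero_le_one]
    exact Icc_subset_Icc_left hsub.1

theorem IsJoined.trans (hX : IsTame X w r S) {δ₁ δ₂ : ℝ} {x y z : V}
    (h₁ : IsJoined X w r S δ₁ x y) (h₂ : IsJoined X w r S δ₂ y z) :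
    IsJoined X w r S (δ₁ + δ₂) x z := by
  obtain ⟨hδ₁, φ₁, a₁, hφS₁, hs₁, he₁, ha₁, hab₁, haz₁, hφ₁⟩ := h₁
  obtain ⟨hδ₂, φ₂, a₂, hφS₂, hs₂, he₂, ha₂, hab₂, haz₂, hφ₂⟩ := h₂
  have hδ : 0 < δ₁ + δ₂ := add_pos hδ₁ hδ₂
  set l : ℝ := δ₁ / (δ₁ + δ₂) with hl
  have hl0 : 0 < l := div_pos hδ₁ hδ
  have hl' : 1 - l = δ₂ / (δ₁ + δ₂) := by rw [hl]; field_simp; ring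
  have hl1 : l < 1 := by have := div_pos hδ₂ hδ; linarith
  have hl1' : 0 < 1 - l := sub_pos.2 hl1
  have mem₁ : ∀ t ∈ Icc (0:ℝ) 1, t ≤ l → t / l ∈ Icc (0:ℝ) 1 := fun t ht h =>
    ⟨div_nonneg ht.1 hl0.le, (div_le_one hl0).2 h⟩
  have mem₂ : ∀ t ∈ Icc (0:ℝ) 1, ¬ t ≤ l → (t - l) / (1 - l) ∈ Icc (0:ℝ) 1 := fun t ht h =>
    ⟨div_nonneg (sub_nonneg.2 (not_le.1 h).le) hl1'.le,
      (div_le_one hl1').2 (by linarith [ht.2])⟩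
  have scale : ∀ (I : MIdx ι r) {δ b : ℝ}, 0 < δ → δ ≤ δ₁ + δ₂ → |b| ≤ δ ^ wtOf w I →
      |(δ / (δ₁ + δ₂))⁻¹ * b| ≤ (δ₁ + δ₂) ^ wtOf w I := by
    intro I δ b h0 hle hb
    obtain ⟨k, hk⟩ := Nat.exists_eq_add_of_le' (one_le_wtOf hX.one_le_weight I)
    rw [abs_mul, abs_of_pos (inv_pos.2 (div_pos h0 hδ)), inv_div]
    rw [hk] at hb ⊢
    calc (δ₁ + δ₂) / δ * |b| ≤ (δ₁ + δ₂) / δ * δ ^ (k + 1) := by gcongr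
      _ = (δ₁ + δ₂) * δ ^ k := by field_simp; ring
      _ ≤ (δ₁ + δ₂) * (δ₁ + δ₂) ^ k := by gcongr
      _ = (δ₁ + δ₂) ^ (k + 1) := by ring
  refine ⟨hδ, fun t => if t ≤ l then φ₁ (t / l) else φ₂ ((t - l) / (1 - l)),
    fun I t => if t ≤ l then l⁻¹ * a₁ I (t / l) else (1 - l)⁻¹ * a₂ I ((t - l) / (1 - l)),
    fun t ht => ?_, ?_, ?_, fun I => ?_, fun I t ht => ?_, fun I hI t => ?_, fun t ht => ?_⟩
  · dsimp only
    split_ifs with h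
    exacts [hφS₁ _ (mem₁ t ht h), hφS₂ _ (mem₂ t ht h)]
  · simp [hl0.le, hs₁]
  · simp [hl1.not_ge, div_self hl1'.ne', he₂]
  · exact Measurable.ite measurableSet_Iic
      (((ha₁ I).comp (measurable_id.div_const l)).const_mul _)
      (((ha₂ I).comp ((measurable_id.sub_const l).div_const (1 - l))).const_mul _)
  · dsimp only
    split_ifs with h
    · exact scale I hδ₁ (by linarith) (hab₁ I _ (mem₁ t ht h))
    · have := scale I hδ₂ (by linarith) (hab₂ I _ (mem₂ t ht h))
      rwa [← hl'] at this
  · simp [haz₁ I hI, haz₂ I hI]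
  · dsimp only
    rw [concat_integral_eq (hX.intervalIntegrable hφS₁ ha₁ hab₁ haz₁ hφ₁)
      (hX.intervalIntegrable hφS₂ ha₂ hab₂ haz₂ hφ₂) hφ₁ hφ₂ he₁ hl0 hl1 ht]
    congr 2
    funext s
    split_ifs with h
    · simp only [Finset.smul_sum, smul_smul]
    · simp only [Finset.smul_sum, smul_smul]

/-- The Euclidean distance is controlled by the size of a joining curve. -/
theorem IsTame.exists_norm_sub_le (hX : IsTame X w r S) (hS : Bornology.IsBounded S) :
    ∃ K > (0:ℝ), ∀ (δ : ℝ) (x y : V), IsJoined X w r S δ x y → ‖x - y‖ ≤ K * δ := by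
  obtain ⟨M, hM0, hM⟩ := hX.exists_bound
  obtain ⟨D, hD⟩ := hS.exists_norm_le
  set N : ℝ := (Fintype.card (MIdx ι r) : ℝ)
  have hN : 0 ≤ N := Nat.cast_nonneg _
  refine ⟨N * M + 2 * |D| + 1, by positivity, fun δ x y h => ?_⟩
  obtain ⟨hδ, φ, a, hφS, h0, h1, ha, hab, ha0, hφ⟩ := h
  rcases le_or_gt δ 1 with h | h
  · have hF : ∀ t ∈ uIoc (0:ℝ) 1, ‖∑ I : MIdx ι r, a I t • commOf X I (φ t)‖ ≤ N * M * δ := by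
      intro t ht
      rw [uIoc_of_le zero_le_one] at ht
      have ht' := Ioc_subset_Icc_self ht
      refine (norm_velocity_le hM0 hM (fun I => hab I t ht') (fun I hI => ha0 I hI t)
        (hφS t ht')).trans ?_
      have : ∀ I ∈ Finset.univ, δ ^ wtOf w (I : MIdx ι r) * M ≤ δ * M := fun I _ =>
        mul_le_mul_of_nonneg_right
          (pow_le_of_le_one hδ.le h (by have := one_le_wtOf hX.one_le_weight I; omega)) hM0
      refine (Finset.sum_le_sum this).trans (le_of_eq ?_)
      simp only [Finset.sum_const, Finset.card_univ, nsmul_eq_mul, N]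
      ring
    have := intervalIntegral.norm_integral_le_of_norm_le_const hF
    rw [sub_zero, abs_one, mul_one] at this
    have e := hφ 1 (by simp)
    rw [h1] at e
    rw [norm_sub_rev, e, add_sub_cancel_left]
    nlinarith [abs_nonneg D]
  · have hx := hD x (h0 ▸ hφS 0 (by simp))
    have hy := hD y (h1 ▸ hφS 1 (by simp))
    have := norm_sub_le x y
    have hD' := le_abs_self D
    nlinarith [mul_nonneg hN hM0, abs_nonneg D]

theorem dCC_eq (x y : V) : dCC X w r S x y = sInf {δ | IsJoined X w r S δ x y} := rfl

theorem IsJoined.dCC_le {δ : ℝ} {x y : V} (h : IsJoined X w r S δ x y) : dCC X w r S x y ≤ δ :=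
  csInf_le ⟨0, fun _ h => h.1.le⟩ h

theorem dCC_self {x : V} (hx : x ∈ S) : dCC X w r S x x = 0 := by
  rw [dCC_eq]
  have : {δ | IsJoined X w r S δ x x} = Ioi 0 :=
    Set.ext fun δ => ⟨fun h => h.1, fun h => isJoined_refl h hx⟩
  rw [this, csInf_Ioi]

theorem IsTame.dCC_comm (hX : IsTame X w r S) (x y : V) : dCC X w r S x y = dCC X w r S y x := by
  simp only [dCC_eq]
  congr 1
  exact Set.ext fun δ => ⟨fun h => h.symm hX, fun h => h.symm hX⟩

theorem IsTame.dCC_triangle (hX : IsTame X w r S) {x y z : V}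
    (h₁ : ∃ δ, IsJoined X w r S δ x y) (h₂ : ∃ δ, IsJoined X w r S δ y z) :
    dCC X w r S x z ≤ dCC X w r S x y + dCC X w r S y z := by
  have step : ∀ δ₂, IsJoined X w r S δ₂ y z → dCC X w r S x z - δ₂ ≤ dCC X w r S x y :=
    fun δ₂ h => le_csInf h₁ fun δ₁ (h' : IsJoined X w r S δ₁ x y) =>
      sub_le_iff_le_add.2 (h'.trans hX h).dCC_le
  have : dCC X w r S x z - dCC X w r S x y ≤ dCC X w r S y z :=
    le_csInf h₂ fun δ₂ h => by linarith [step δ₂ h]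
  linarith

/-- Near every point the segment from `x` to `y` is an admissible curve: its velocity is a
bounded combination of commutators of weight at most `r`. -/
theorem IsTame.exists_isJoined_of_span [FiniteDimensional ℝ V] (hX : IsTame X w r S)
    (hr : r ≠ 0) (hS : IsOpen S) (hspan : HormSpan X w r S) {x₀ : V} (hx₀ : x₀ ∈ S) :
    ∃ ρ > (0:ℝ), ∃ C > (0:ℝ), ∀ x ∈ Metric.ball x₀ ρ, ∀ y ∈ Metric.ball x₀ ρ, x ≠ y →
      IsJoined X w r S (C * ‖x - y‖ ^ ((r : ℝ)⁻¹)) x y := by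
  classical
  have : CompleteSpace V := FiniteDimensional.complete ℝ V
  set g : MIdx ι r → V := fun I => if wtOf w I ≤ r then commOf X I x₀ else 0 with hg
  have hsurj : LinearMap.range (Fintype.linearCombination ℝ g) = ⊤ := by
    rw [Fintype.range_linearCombination, eq_top_iff, ← hspan x₀ hx₀]
    refine Submodule.span_mono ?_
    rintro v ⟨I, hI, rfl⟩
    exact ⟨I, by simp [hg, hI]⟩
  obtain ⟨R, hR⟩ := LinearMap.exists_rightInverse_of_surjective _ hsurj
  set σ : MIdx ι r → V →L[ℝ] ℝ := fun I =>
    if wtOf w I ≤ r then LinearMap.toContinuousLinearMap ((LinearMap.proj I).comp R) else 0 with hσ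
  have hσ0 : ∀ I, r < wtOf w I → σ I = 0 := fun I hI => by simp [hσ, not_le.2 hI]
  set T : V → V →L[ℝ] V := fun z => ∑ I, (σ I).smulRight (commOf X I z) with hT
  have hTapp : ∀ z v, T z v = ∑ I, σ I v • commOf X I z := fun z v => by
    simp [hT]
  have hT0 : T x₀ = 1 := by
    ext1 v
    have h := LinearMap.congr_fun hR v
    simp only [LinearMap.comp_apply, Fintype.linearCombination_apply, LinearMap.id_apply] at h
    rw [hTapp, one_apply_eq_self]
    conv_rhs => rw [← h]
    refine Finset.sum_congr rfl fun I _ => ?_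
    by_cases hI : wtOf w I ≤ r <;> simp [hσ, hg, hI]
  have hTc : ContinuousOn T S := by
    refine continuousOn_finsetSum _ fun I _ => ?_
    rcases le_or_gt (wtOf w I) r with h | h
    · exact ((ContinuousLinearMap.smulRightL ℝ V V (σ I)).continuous.comp_continuousOn
        (hX.continuousOn I h))
    · simp only [hσ0 I h, ContinuousLinearMap.zero_smulRight]
      exact continuousOn_const
  have hTat : ContinuousAt T x₀ := hTc.continuousAt (hS.mem_nhds hx₀)
  have hU : ∀ᶠ z in 𝓝 x₀, IsUnit (T z) :=
    hTat (Units.isOpen.mem_nhds (by rw [hT0]; exact isUnit_one))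
  have hinv : ∀ z ∈ S, IsUnit (T z) → ContinuousAt (fun z => Ring.inverse (T z)) z := by
    rintro z hz ⟨u, hu⟩
    have := NormedRing.inverse_continuousAt u
    rw [hu] at this
    exact ContinuousAt.comp (g := Ring.inverse) this (hTc.continuousAt (hS.mem_nhds hz))
  set B : ℝ := ‖Ring.inverse (T x₀)‖ + 1 with hB
  have hBev : ∀ᶠ z in 𝓝 x₀, ‖Ring.inverse (T z)‖ < B :=
    (hinv x₀ hx₀ (by rw [hT0]; exact isUnit_one)).norm (Iio_mem_nhds (lt_add_one _))
  obtain ⟨ε, hε, hball⟩ := Metric.eventually_nhds_iff_ball.1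
    ((hS.eventually_mem hx₀).and (hU.and hBev))
  set K : ℝ := (∑ I, ‖σ I‖) * B + 1 with hK
  have hB0 : 0 ≤ B := by positivity
  have hK0 : 0 < K := by positivity
  refine ⟨min ε (1 / (2 * K)), lt_min hε (by positivity), K ^ ((r : ℝ)⁻¹), by positivity,
    fun x hx y hy hxy => ?_⟩
  have hd : 0 < ‖x - y‖ := norm_pos_iff.2 (sub_ne_zero.2 hxy)
  rw [← Real.mul_rpow hK0.le hd.le]
  set δ : ℝ := (K * ‖x - y‖) ^ ((r : ℝ)⁻¹) with hδdef
  have hδ : 0 < δ := by positivity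
  have hδr : δ ^ r = K * ‖x - y‖ := Real.rpow_inv_natCast_pow (by positivity) hr
  have hsmall : K * ‖x - y‖ ≤ 1 := by
    have h1 := hx.trans_le (min_le_right ε (1 / (2 * K)))
    have h2 := hy.trans_le (min_le_right ε (1 / (2 * K)))
    have h3 := dist_triangle_right x y x₀
    rw [dist_eq_norm x y] at h3
    calc K * ‖x - y‖ ≤ K * (1 / (2 * K) + 1 / (2 * K)) := by gcongr; linarith
      _ = 1 := by field_simp; norm_num
  have hδ1 : δ ≤ 1 := Real.rpow_le_one (by positivity) hsmall (by positivity)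
  set c : ℝ → ℝ := fun t => max 0 (min 1 t) with hc
  have hcc : Continuous c := by fun_prop
  have hct : ∀ t ∈ Icc (0:ℝ) 1, c t = t := fun t ht => by
    simp only [hc, min_eq_right ht.2, max_eq_right ht.1]
  set φ : ℝ → V := fun t => x + c t • (y - x) with hφ
  have hφc : Continuous φ := by fun_prop
  have hφball : ∀ t, φ t ∈ Metric.ball x₀ ε := fun t =>
    (convex_ball x₀ ε).add_smul_sub_mem (Metric.ball_subset_ball (min_le_left _ _) hx)
      (Metric.ball_subset_ball (min_le_left _ _) hy)
      ⟨le_max_left _ _, max_le zero_le_one (min_le_left _ _)⟩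
  have hinvc : Continuous fun t => Ring.inverse (T (φ t)) :=
    continuous_iff_continuousAt.2 fun t =>
      ContinuousAt.comp (f := φ) (g := fun z => Ring.inverse (T z))
        (hinv _ (hball _ (hφball t)).1 (hball _ (hφball t)).2.1) hφc.continuousAt
  have hvel : ∀ s, ∑ I, σ I (Ring.inverse (T (φ s)) (y - x)) • commOf X I (φ s) = y - x := by
    intro s
    rw [← hTapp, ← mul_apply_eq_comp,
      Ring.mul_inverse_cancel _ (hball _ (hφball s)).2.1, one_apply_eq_self]
  refine ⟨hδ, φ, fun I t => σ I (Ring.inverse (T (φ t)) (y - x)),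
    fun t _ => (hball _ (hφball t)).1, ?_, ?_, fun I => ?_, fun I t _ => ?_, fun I hI t => ?_,
    fun t ht => ?_⟩
  · simp [hφ, hc]
  · simp [hφ, hc]
  · exact ((σ I).continuous.comp (hinvc.clm_apply continuous_const)).measurable
  · rcases le_or_gt (wtOf w I) r with h | h
    · have h1 : ‖σ I‖ ≤ ∑ I, ‖σ I‖ :=
        Finset.single_le_sum (f := fun I => ‖σ I‖) (fun _ _ => norm_nonneg _) (Finset.mem_univ I)
      have h2 := (hball _ (hφball t)).2.2.le
      calc |σ I (Ring.inverse (T (φ t)) (y - x))|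
          ≤ ‖σ I‖ * (‖Ring.inverse (T (φ t))‖ * ‖y - x‖) :=
            ((σ I).le_opNorm _).trans
              (mul_le_mul_of_nonneg_left (ContinuousLinearMap.le_opNorm _ _) (norm_nonneg _))
        _ ≤ (∑ I, ‖σ I‖) * (B * ‖y - x‖) := by gcongr
        _ ≤ K * ‖x - y‖ := by rw [hK, norm_sub_rev y x]; nlinarith
        _ = δ ^ r := hδr.symm
        _ ≤ δ ^ wtOf w I := pow_le_pow_of_le_one hδ.le hδ1 h
    · simp only [hσ0 I h, zero_apply, abs_zero]
      positivity
  · simp [hσ0 I hI]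
  · simp only [hvel, intervalIntegral.integral_const, sub_zero]
    rw [hφ]
    simp only [hct t ht]

theorem IsTame.exists_dCC_le_of_span [FiniteDimensional ℝ V] (hX : IsTame X w r S)
    (hr : r ≠ 0) (hS : IsOpen S) (hspan : HormSpan X w r S) {x₀ : V} (hx₀ : x₀ ∈ S) :
    ∃ ρ > (0:ℝ), ∃ C > (0:ℝ), ∀ x ∈ Metric.ball x₀ ρ, ∀ y ∈ Metric.ball x₀ ρ, x ∈ S →
      dCC X w r S x y ≤ C * ‖x - y‖ ^ ((r : ℝ)⁻¹) := by
  obtain ⟨ρ, hρ, C, hC, h⟩ := hX.exists_isJoined_of_span hr hS hspan hx₀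
  refine ⟨ρ, hρ, C, hC, fun x hx y hy hxS => ?_⟩
  rcases eq_or_ne x y with rfl | hxy
  · rw [dCC_self hxS]; positivity
  · exact (h x hx y hy hxy).dCC_le

theorem IsTame.exists_isJoined [FiniteDimensional ℝ V] (hX : IsTame X w r S)
    (hr : r ≠ 0) (hS : IsOpen S) (hconn : IsPreconnected S) (hspan : HormSpan X w r S)
    {x y : V} (hx : x ∈ S) (hy : y ∈ S) : ∃ δ, IsJoined X w r S δ x y := by
  refine hconn.induction₂ (fun x y => ∃ δ, IsJoined X w r S δ x y) ?_ ?_ ?_ hx hy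
  · intro x₀ hx₀
    obtain ⟨ρ, hρ, C, hC, h⟩ := hX.exists_isJoined_of_span hr hS hspan hx₀
    filter_upwards [mem_nhdsWithin_of_mem_nhds (Metric.ball_mem_nhds x₀ hρ)] with z hz
    rcases eq_or_ne x₀ z with rfl | hne
    · exact ⟨1, isJoined_refl one_pos hx₀⟩
    · exact ⟨_, h x₀ (Metric.mem_ball_self hρ) z hz hne⟩
  · rintro a b c - - - ⟨δ₁, h₁⟩ ⟨δ₂, h₂⟩
    exact ⟨_, h₁.trans hX h₂⟩
  · rintro a b - - ⟨δ, h⟩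
    exact ⟨δ, h.symm hX⟩

/-- The subelliptic distance is Hölder continuous of exponent `1 / r` on compact sets. -/
theorem IsTame.exists_dCC_le_on_compact [FiniteDimensional ℝ V] (hX : IsTame X w r S)
    (hr : r ≠ 0) (hS : IsOpen S) (hconn : IsPreconnected S) (hspan : HormSpan X w r S)
    {A : Set V} (hA : IsCompact A) (hAS : A ⊆ S) :
    ∃ c > (0:ℝ), ∀ x ∈ A, ∀ y ∈ A, dCC X w r S x y ≤ c * ‖x - y‖ ^ ((r : ℝ)⁻¹) := by
  have key : ∃ c > (0:ℝ), ∀ q ∈ A ×ˢ A, q.1 ∈ S → q.2 ∈ S →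
      dCC X w r S q.1 q.2 ≤ c * ‖q.1 - q.2‖ ^ ((r : ℝ)⁻¹) := by
    refine (hA.prod hA).induction_on (p := fun Q => ∃ c > (0:ℝ), ∀ q ∈ Q, q.1 ∈ S → q.2 ∈ S →
      dCC X w r S q.1 q.2 ≤ c * ‖q.1 - q.2‖ ^ ((r : ℝ)⁻¹)) ⟨1, one_pos, by simp⟩ ?_ ?_ ?_
    · rintro s t hst ⟨c, hc, h⟩
      exact ⟨c, hc, fun q hq => h q (hst hq)⟩
    · rintro s t ⟨c, hc, h⟩ ⟨c', hc', h'⟩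
      refine ⟨max c c', lt_max_of_lt_left hc, fun q hq h₁ h₂ => ?_⟩
      rcases hq with hq | hq
      · exact (h q hq h₁ h₂).trans (by gcongr; exact le_max_left _ _)
      · exact (h' q hq h₁ h₂).trans (by gcongr; exact le_max_right _ _)
    · rintro ⟨x₀, y₀⟩ ⟨hx₀, hy₀⟩
      have hx₀S := hAS hx₀
      have hy₀S := hAS hy₀
      obtain ⟨ρ, hρ, C, hC, h⟩ := hX.exists_dCC_le_of_span hr hS hspan hx₀S
      obtain ⟨ρ', hρ', C', hC', h'⟩ := hX.exists_dCC_le_of_span hr hS hspan hy₀S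
      rcases eq_or_ne x₀ y₀ with rfl | hne
      · refine ⟨Metric.ball x₀ ρ ×ˢ Metric.ball x₀ ρ, mem_nhdsWithin_of_mem_nhds
          (prod_mem_nhds (Metric.ball_mem_nhds _ hρ) (Metric.ball_mem_nhds _ hρ)), C, hC, ?_⟩
        rintro q ⟨hq₁, hq₂⟩ h₁ -
        exact h _ hq₁ _ hq₂ h₁
      · have hd : 0 < dist x₀ y₀ := dist_pos.2 hne
        set τ : ℝ := dist x₀ y₀ / 4 with hτ
        have hτ0 : 0 < τ := by positivity
        set D : ℝ := C * ρ ^ ((r : ℝ)⁻¹) + |dCC X w r S x₀ y₀| + C' * ρ' ^ ((r : ℝ)⁻¹) with hD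
        have hD0 : 0 < D := by positivity
        refine ⟨Metric.ball x₀ (min ρ τ) ×ˢ Metric.ball y₀ (min ρ' τ), mem_nhdsWithin_of_mem_nhds
          (prod_mem_nhds (Metric.ball_mem_nhds _ (lt_min hρ hτ0))
            (Metric.ball_mem_nhds _ (lt_min hρ' hτ0))),
          D / τ ^ ((r : ℝ)⁻¹), by positivity, ?_⟩
        rintro ⟨x, y⟩ ⟨hx, hy⟩ hxS hyS
        simp only [Metric.mem_ball, lt_min_iff] at hx hy hxS hyS ⊢
        have J : ∀ {a b : V}, a ∈ S → b ∈ S → ∃ δ, IsJoined X w r S δ a b := fun ha hb =>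
          hX.exists_isJoined hr hS hconn hspan ha hb
        have t₁ := hX.dCC_triangle (J hxS hx₀S) (J hx₀S hyS)
        have t₂ := hX.dCC_triangle (J hx₀S hy₀S) (J hy₀S hyS)
        have b₁ : dCC X w r S x x₀ ≤ C * ρ ^ ((r : ℝ)⁻¹) := by
          refine (h x hx.1 x₀ (Metric.mem_ball_self hρ) hxS).trans ?_
          rw [← dist_eq_norm]
          gcongr
          exact hx.1.le
        have b₂ : dCC X w r S y₀ y ≤ C' * ρ' ^ ((r : ℝ)⁻¹) := by
          refine (h' y₀ (Metric.mem_ball_self hρ') y hy.1 hy₀S).trans ?_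
          rw [← dist_eq_norm, dist_comm]
          gcongr
          exact hy.1.le
        have hτle : τ ≤ ‖x - y‖ := by
          rw [← dist_eq_norm]
          have := dist_triangle4 x₀ x y y₀
          rw [dist_comm x₀ x] at this
          have h4 : dist x₀ y₀ = 4 * τ := by rw [hτ]; ring
          linarith [hx.2, hy.2]
        calc dCC X w r S x y ≤ D := by linarith [le_abs_self (dCC X w r S x₀ y₀)]
          _ = D / τ ^ ((r : ℝ)⁻¹) * τ ^ ((r : ℝ)⁻¹) := by
            rw [div_mul_cancel₀ _ (by positivity)]
          _ ≤ D / τ ^ ((r : ℝ)⁻¹) * ‖x - y‖ ^ ((r : ℝ)⁻¹) := by gcongr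
  obtain ⟨c, hc, h⟩ := key
  exact ⟨c, hc, fun x hx y hy => h (x, y) ⟨hx, hy⟩ (hAS hx) (hAS hy)⟩

theorem isTame_of_contDiffOn [FiniteDimensional ℝ V] (hS : IsOpen S)
    (hb : Bornology.IsBounded S) (hw : ∀ i, 1 ≤ w i)
    (hX : ∀ i, ContDiffOn ℝ (r - w i : ℕ) (X i) (closure S)) : IsTame X w r S := by
  have : ProperSpace V := FiniteDimensional.proper ℝ V
  have hsm : ∀ I : MIdx ι r, wtOf w I ≤ r → SmoothUpTo S (r - wtOf w I) (commOf X I) := fun I hI =>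
    SmoothUpTo.iterComm hS hw (fun i => (hX i).smoothUpTo) I.1.1 I.2 hI
  refine ⟨hw, fun I hI => (hsm I hI).continuousOn, ?_⟩
  have hbd : ∀ I : MIdx ι r, ∃ M : ℝ, wtOf w I ≤ r → ∀ z ∈ S, ‖commOf X I z‖ ≤ M := by
    intro I
    rcases le_or_gt (wtOf w I) r with h | h
    · obtain ⟨M, hM⟩ := (hsm I h).exists_bound hb.isCompact_closure
      exact ⟨M, fun _ => hM⟩
    · exact ⟨0, fun h' => absurd h' (not_le.2 h)⟩
  choose M hM using hbd
  refine ⟨∑ I, |M I|, fun I hI z hz => (hM I hI z hz).trans ((le_abs_self _).trans ?_)⟩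
  exact Finset.single_le_sum (f := fun I => |M I|) (fun _ _ => abs_nonneg _) (Finset.mem_univ I)

end Curves

/-- Proposition: relation with the Euclidean distance.
Under Assumptions (A), the function `d` is a (finite) distance on `Ω`; there is
`c₁ > 0` (depending on `Ω` and the `X_i`'s) and, for every `Ω' ⋐ Ω`, a constant
`c₂ > 0` with `c₁|x-y| ≤ d(x,y) ≤ c₂|x-y|^{1/r}` on `Ω'`; in particular `d`
induces the Euclidean topology. -/
theorem subelliptic_distance_basic
    (p n r : ℕ) (hr : 2 ≤ r) (hnp : n < p)
    (Ω : Set (E p)) (hΩo : IsOpen Ω) (hΩconn : IsConnected Ω)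
    (hΩb : Bornology.IsBounded Ω)
    (X : Fin (n + 1) → E p → E p)
    (hXreg : ∀ i : Fin n, ContDiffOn ℝ (r - 1 : ℕ) (X i.succ) (closure Ω))
    (hX0reg : ContDiffOn ℝ (r - 2 : ℕ) (X 0) (closure Ω))
    (hHor : HormSpan X wgt r Ω) :
    (∀ x ∈ Ω, dCC X wgt r Ω x x = 0) ∧
    (∀ x ∈ Ω, ∀ y ∈ Ω, x ≠ y → 0 < dCC X wgt r Ω x y) ∧
    (∀ x ∈ Ω, ∀ y ∈ Ω, dCC X wgt r Ω x y = dCC X wgt r Ω y x) ∧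
    (∀ x ∈ Ω, ∀ y ∈ Ω, ∀ z ∈ Ω,
      dCC X wgt r Ω x z ≤ dCC X wgt r Ω x y + dCC X wgt r Ω y z) ∧
    (∃ c₁ > (0:ℝ), ∀ Ω' : Set (E p), IsOpen Ω' → closure Ω' ⊆ Ω →
      IsCompact (closure Ω') →
      ∃ c₂ > (0:ℝ), ∀ x ∈ Ω', ∀ y ∈ Ω',
        c₁ * ‖x - y‖ ≤ dCC X wgt r Ω x y ∧
        dCC X wgt r Ω x y ≤ c₂ * ‖x - y‖ ^ ((r : ℝ)⁻¹)) ∧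
    (∀ x ∈ Ω,
      (∀ ε > (0:ℝ), ∃ δ > (0:ℝ), ∀ y ∈ Ω, dCC X wgt r Ω x y < δ → ‖y - x‖ < ε) ∧
      (∀ ε > (0:ℝ), ∃ δ > (0:ℝ), ∀ y ∈ Ω, ‖y - x‖ < δ → dCC X wgt r Ω x y < ε)) := by
  have hw : ∀ i : Fin (n + 1), 1 ≤ wgt i := fun i => by unfold wgt; split_ifs <;> norm_num
  have hT : IsTame X wgt r Ω := by
    refine isTame_of_contDiffOn hΩo hΩb hw fun i => ?_
    refine Fin.cases ?_ (fun i => ?_) i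
    · simpa [wgt] using hX0reg
    · simpa [wgt, Fin.succ_ne_zero] using hXreg i
  have hr0 : r ≠ 0 := by omega
  have J : ∀ {x y : E p}, x ∈ Ω → y ∈ Ω → ∃ δ, IsJoined X wgt r Ω δ x y := fun hx hy =>
    hT.exists_isJoined hr0 hΩo hΩconn.isPreconnected hHor hx hy
  obtain ⟨K, hK, hKle⟩ := hT.exists_norm_sub_le hΩb
  have lower : ∀ x ∈ Ω, ∀ y ∈ Ω, K⁻¹ * ‖x - y‖ ≤ dCC X wgt r Ω x y := fun x hx y hy =>
    le_csInf (J hx hy) fun δ (h : IsJoined X wgt r Ω δ x y) =>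
      (inv_mul_le_iff₀ hK).2 (hKle δ x y h)
  refine ⟨fun x hx => dCC_self hx, fun x hx y hy hxy => ?_, fun x _ y _ => hT.dCC_comm x y,
    fun x hx y hy z hz => hT.dCC_triangle (J hx hy) (J hy hz),
    ⟨K⁻¹, inv_pos.2 hK, fun Ω' _ hsub hcpt => ?_⟩,
    fun x hx => ⟨fun ε hε => ⟨K⁻¹ * ε, by positivity, fun y hy h => ?_⟩, fun ε hε => ?_⟩⟩
  · exact (mul_pos (inv_pos.2 hK) (norm_pos_iff.2 (sub_ne_zero.2 hxy))).trans_le (lower x hx y hy)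
  · obtain ⟨c, hc, h⟩ :=
      hT.exists_dCC_le_on_compact hr0 hΩo hΩconn.isPreconnected hHor hcpt hsub
    exact ⟨c, hc, fun x hx y hy =>
      ⟨lower x (hsub (subset_closure hx)) y (hsub (subset_closure hy)),
        h x (subset_closure hx) y (subset_closure hy)⟩⟩
  · have := (lower x hx y hy).trans_lt h
    rw [norm_sub_rev]
    exact lt_of_mul_lt_mul_left this (inv_pos.2 hK).le
  · obtain ⟨ρ, hρ, C, hC, h⟩ := hT.exists_dCC_le_of_span hr0 hΩo hHor hx
    have hlim : Filter.Tendsto (fun y => C * ‖x - y‖ ^ ((r : ℝ)⁻¹)) (𝓝 x) (𝓝 0) := by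
      have hcont : Continuous fun y => C * ‖x - y‖ ^ ((r : ℝ)⁻¹) :=
        continuous_const.mul ((continuous_const.sub continuous_id).norm.rpow_const
          fun _ => Or.inr (by positivity))
      have h0 : (r : ℝ)⁻¹ ≠ 0 := inv_ne_zero (Nat.cast_ne_zero.2 hr0)
      have := hcont.tendsto x
      rwa [sub_self, norm_zero, Real.zero_rpow h0, mul_zero] at this
    obtain ⟨δ, hδ, hball⟩ := Metric.eventually_nhds_iff_ball.1
      ((hlim.eventually (gt_mem_nhds hε)).and (Metric.ball_mem_nhds x hρ))
    refine ⟨δ, hδ, fun y _ hyx => ?_⟩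
    have hy := hball y (by rwa [Metric.mem_ball, dist_eq_norm])
    exact (h x (Metric.mem_ball_self hρ) y hy.2 hx).trans_lt hy.1

end
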